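/- arXiv:2103.09295 — 3 statements merged into one kernel-verified Lean document; each statement's English description precedes it below -/
import Mathlib

section
/- Fix β ∈ (0, 0.1) and define h : ℝ → ℝ by h(δ) = (0.1(1-δ) + δ)/(1 - β(1-δ)). Then: (i) h(δ) > 0.1/(1-β) for every δ ∈ (0,1]; (ii) h(δ) → 0.1/(1-β) as δ → 0 from the right; consequently the infimum of h over (0,1] equals 0.1/(1-β) and is not attained by any δ ∈ (0,1]. -/
/-- Fix `β ∈ (0, 0.1)` and define `h(δ) = (0.1(1-δ) + δ)/(1 - β(1-δ))`. Then
(i) `h(δ) > 0.1/(1-β)` for every `δ ∈ (0,1]`;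
(ii) `h(δ) → 0.1/(1-β)` as `δ → 0⁺`;
consequently the infimum of `h` over `(0,1]` equals `0.1/(1-β)` and is not
attained by any `δ ∈ (0,1]`. -/
theorem stmt_2 (β : ℝ) (hβ : β ∈ Set.Ioo (0 : ℝ) 0.1)
    (h : ℝ → ℝ) (hh : ∀ δ, h δ = (0.1 * (1 - δ) + δ) / (1 - β * (1 - δ))) :
    (∀ δ ∈ Set.Ioc (0 : ℝ) 1, 0.1 / (1 - β) < h δ) ∧
    Filter.Tendsto h (nhdsWithin 0 (Set.Ioi 0)) (nhds (0.1 / (1 - β))) ∧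
    IsGLB (h '' Set.Ioc (0 : ℝ) 1) (0.1 / (1 - β)) ∧
    ¬ ∃ δ ∈ Set.Ioc (0 : ℝ) 1, h δ = 0.1 / (1 - β) := by
  obtain ⟨hβ0, hβ1⟩ := hβ
  norm_num at hβ1
  have lower : ∀ δ ∈ Set.Ioc (0 : ℝ) 1, 0.1 / (1 - β) < h δ := by
    rintro δ ⟨hδ0, hδ1⟩
    have hβδ : 0 < β * δ := mul_pos hβ0 hδ0
    rw [hh, div_lt_div_iff₀ (by linarith) (by linarith)]
    have gap : 0 < δ * (0.9 - β) := mul_pos hδ0 (by norm_num; linarith)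
    norm_num at gap ⊢
    linarith
  have limit : Filter.Tendsto h (nhdsWithin 0 (Set.Ioi 0)) (nhds (0.1 / (1 - β))) := by
    have cont : ContinuousAt h 0 := by
      rw [funext hh]
      refine ContinuousAt.div (by fun_prop) (by fun_prop) ?_
      linarith
    have value : h 0 = 0.1 / (1 - β) := by rw [hh]; norm_num
    rw [← value]
    exact cont.tendsto.mono_left nhdsWithin_le_nhds
  refine ⟨lower, limit, ⟨?_, fun b hb => ?_⟩, ?_⟩
  · rintro _ ⟨δ, hδ, rfl⟩
    exact (lower δ hδ).le
  · refine ge_of_tendsto limit ?_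
    filter_upwards [Ioc_mem_nhdsGT (zero_lt_one' ℝ)] with δ hδ
    exact hb (Set.mem_image_of_mem h hδ)
  · rintro ⟨δ, hδ, hδ_eq⟩
    exact (lower δ hδ).ne' hδ_eq
end

section
/- Let S be a finite nonempty type, let P, M be real matrices indexed by S, let c, v, α : S → ℝ, let β ∈ (0,1) and ε > 0, and set P' = P + ε·M and c' = c + ε·v. Suppose I - β·P and I - β·P' are both invertible. Define γ₁ = β · αᵀ(I - β·P)^{-1} M (I - β·P')^{-1} c and γ₂ = αᵀ(I - β·P')^{-1} v. Then αᵀ(I - β·P')^{-1} c' = αᵀ(I - β·P)^{-1} c + ε(γ₁ + γ₂). -/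
open Matrix

/-- Perturbed-cost identity (central computation in the proof of Theorem 1):
with `P' = P + ε·M`, `c' = c + ε·v`, both `I - β·P` and `I - β·P'` invertible,
`γ₁ = β αᵀ(I-βP)⁻¹ M (I-βP')⁻¹ c` and `γ₂ = αᵀ(I-βP')⁻¹ v`, one has
`αᵀ(I-βP')⁻¹ c' = αᵀ(I-βP)⁻¹ c + ε(γ₁ + γ₂)`. -/
theorem stmt_7 {S : Type*} [Fintype S] [Nonempty S] [DecidableEq S]
    (P M : Matrix S S ℝ) (c v α : S → ℝ) (β ε : ℝ)
    (hβ : β ∈ Set.Ioo (0 : ℝ) 1) (hε : 0 < ε)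
    (P' : Matrix S S ℝ) (hP' : P' = P + ε • M)
    (c' : S → ℝ) (hc' : c' = c + ε • v)
    (h1 : IsUnit (1 - β • P)) (h2 : IsUnit (1 - β • P'))
    (γ₁ γ₂ : ℝ)
    (hγ₁ : γ₁ = β * (α ⬝ᵥ (((1 - β • P)⁻¹ * M * (1 - β • P')⁻¹) *ᵥ c)))
    (hγ₂ : γ₂ = α ⬝ᵥ ((1 - β • P')⁻¹ *ᵥ v)) :
    α ⬝ᵥ ((1 - β • P')⁻¹ *ᵥ c')
      = α ⬝ᵥ ((1 - β • P)⁻¹ *ᵥ c) + ε * (γ₁ + γ₂) := by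
  have hsub : (1 - β • P') - (1 - β • P) = -((β * ε) • M) := by
    rw [hP', smul_add, smul_smul]
    abel
  have hinv : (1 - β • P')⁻¹
      = (1 - β • P)⁻¹ + (β * ε) • ((1 - β • P)⁻¹ * M * (1 - β • P')⁻¹) := by
    rw [← sub_eq_iff_eq_add', ← neg_sub (1 - β • P)⁻¹,
      Matrix.inv_sub_inv (iff_of_true h1 h2), hsub, mul_neg, neg_mul, neg_neg, mul_smul_comm, smul_mul_assoc]
  have hc : α ⬝ᵥ ((1 - β • P')⁻¹ *ᵥ c) = α ⬝ᵥ ((1 - β • P)⁻¹ *ᵥ c) + ε * γ₁ := by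
    conv_lhs => rw [hinv]
    rw [add_mulVec, smul_mulVec, dotProduct_add, dotProduct_smul, smul_eq_mul, hγ₁]
    ring
  rw [hc', mulVec_add, mulVec_smul, dotProduct_add, dotProduct_smul, smul_eq_mul, hc, hγ₂]
  ring
end

section
/- Let S be a finite nonempty type, let P, M be real matrices indexed by S, let c, v, α : S → ℝ, let β ∈ (0,1), and set P' = P + ε'·M and c' = c + ε'·v for a constant ε' > 0. Suppose I - β·P and I - β·P' are both invertible, and define γ₁ = β · αᵀ(I - β·P)^{-1} M (I - β·P')^{-1} c and γ₂ = αᵀ(I - β·P')^{-1} v. If γ₁ + γ₂ > 0 and ε' ≤ ε/(γ₁ + γ₂) for a given ε > 0, then αᵀ(I - β·P')^{-1} c' ≤ αᵀ(I - β·P)^{-1} c + ε. -/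
open Matrix

/-- Second resolvent identity for the nonsingular inverse. -/
theorem Matrix.inv_eq_inv_add_inv_mul_sub_mul_inv {n R : Type*} [Fintype n] [DecidableEq n]
    [CommRing R] {A B : Matrix n n R} (hA : IsUnit A) (hB : IsUnit B) :
    B⁻¹ = A⁻¹ + A⁻¹ * (A - B) * B⁻¹ := by
  have hA' : A⁻¹ * A = 1 := nonsing_inv_mul A ((isUnit_iff_isUnit_det A).mp hA)
  have hB' : B * B⁻¹ = 1 := mul_nonsing_inv B ((isUnit_iff_isUnit_det B).mp hB)
  rw [mul_sub, sub_mul, hA', one_mul, mul_assoc, hB', mul_one, add_sub_cancel]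

/-- Quantitative conclusion of Theorem 1: with `P' = P + ε'·M`, `c' = c + ε'·v`,
both `I - β·P` and `I - β·P'` invertible, `γ₁ + γ₂ > 0` and
`ε' ≤ ε/(γ₁ + γ₂)`, one has `αᵀ(I-βP')⁻¹ c' ≤ αᵀ(I-βP)⁻¹ c + ε`. -/
theorem stmt_8 {S : Type*} [Fintype S] [Nonempty S] [DecidableEq S]
    (P M : Matrix S S ℝ) (c v α : S → ℝ) (β ε' : ℝ)
    (hβ : β ∈ Set.Ioo (0 : ℝ) 1) (hε' : 0 < ε')
    (P' : Matrix S S ℝ) (hP' : P' = P + ε' • M)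
    (c' : S → ℝ) (hc' : c' = c + ε' • v)
    (h1 : IsUnit (1 - β • P)) (h2 : IsUnit (1 - β • P'))
    (γ₁ γ₂ : ℝ)
    (hγ₁ : γ₁ = β * (α ⬝ᵥ (((1 - β • P)⁻¹ * M * (1 - β • P')⁻¹) *ᵥ c)))
    (hγ₂ : γ₂ = α ⬝ᵥ ((1 - β • P')⁻¹ *ᵥ v))
    (ε : ℝ) (hγpos : 0 < γ₁ + γ₂) (hεbound : ε' ≤ ε / (γ₁ + γ₂)) :
    α ⬝ᵥ ((1 - β • P')⁻¹ *ᵥ c') ≤ α ⬝ᵥ ((1 - β • P)⁻¹ *ᵥ c) + ε := by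
  have hdiff : (1 - β • P) - (1 - β • P') = (ε' * β) • M := by
    rw [hP', smul_add, smul_smul, mul_comm β]
    abel
  have hinv : (1 - β • P')⁻¹ =
      (1 - β • P)⁻¹ + (ε' * β) • ((1 - β • P)⁻¹ * M * (1 - β • P')⁻¹) := by
    conv_lhs => rw [inv_eq_inv_add_inv_mul_sub_mul_inv h1 h2, hdiff]
    rw [mul_smul_comm, smul_mul_assoc]
  have hc : α ⬝ᵥ ((1 - β • P')⁻¹ *ᵥ c) = α ⬝ᵥ ((1 - β • P)⁻¹ *ᵥ c) + ε' * γ₁ := by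
    conv_lhs => rw [hinv]
    rw [add_mulVec, dotProduct_add, smul_mulVec, dotProduct_smul, smul_eq_mul, hγ₁, mul_assoc]
  have hsplit : α ⬝ᵥ ((1 - β • P')⁻¹ *ᵥ c') =
      α ⬝ᵥ ((1 - β • P)⁻¹ *ᵥ c) + ε' * (γ₁ + γ₂) := by
    rw [hc', mulVec_add, dotProduct_add, hc, mulVec_smul, dotProduct_smul, smul_eq_mul, ← hγ₂]
    ring
  rw [hsplit]
  gcongr
  exact (le_div_iff₀ hγpos).mp hεbound
end
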